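/- arXiv:1601.04975 — 4 statements merged into one kernel-verified Lean document; each statement's English description precedes it below -/
import Mathlib

section
/- Let n ≥ 2 and let d satisfy d ≤ n − 1 and 3d ≥ n + 4. Let 𝒮 be any family of unordered pairs {S,T} of disjoint nonempty subsets of {1,…,n} with |S| + |T| = n − d + 1. Let Δ𝒮 be the set of unordered pairs {S',T'} of disjoint nonempty subsets with |S'| + |T'| = n − d + 2 that are obtained from some member {S,T} of 𝒮 by adjoining a single element of {1,…,n} \ (S ∪ T) to S or to T. Then |Δ𝒮| ≥ |𝒮|. -/
/-- `z'` arises from the unordered pair `z` by adjoining a new element to one of its members. -/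
def Adjoins {α : Type*} [DecidableEq α] (z z' : Sym2 (Finset α)) : Prop :=
  ∃ S T : Finset α, ∃ a : α, z = s(S, T) ∧ a ∉ S ∧ a ∉ T ∧ z' = s(insert a S, T)

/-- If `S'` and `T'` are disjoint, every pair from which `{S', T'}` arises by adjoining an element
is obtained by erasing an element of `S' ∪ T'`. -/
lemma Adjoins.mem_image_erase {α : Type*} [DecidableEq α] {z : Sym2 (Finset α)}
    {S' T' : Finset α} (hST : Disjoint S' T') (h : Adjoins z s(S', T')) :
    z ∈ (S' ∪ T').image fun a => s(S'.erase a, T'.erase a) := by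
  obtain ⟨S, T, a, rfl, haS, haT, h⟩ := h
  rw [Finset.mem_image]
  refine ⟨a, ?_⟩
  rcases Sym2.eq_iff.1 h with ⟨rfl, rfl⟩ | ⟨rfl, rfl⟩
  · simp [haS, haT]
  · simp [haS, haT, Sym2.eq_swap]

/-- A pair of disjoint sets, the first one nonempty, has two extensions for every element outside
its union. -/
lemma two_mul_card_compl_le_card_of_adjoins {α : Type*} [Fintype α] [DecidableEq α]
    {S T : Finset α} (hST : Disjoint S T) (hS : S.Nonempty) (u : Finset (Sym2 (Finset α)))
    (hu : ∀ a, a ∉ S → a ∉ T → s(insert a S, T) ∈ u ∧ s(S, insert a T) ∈ u) :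
    2 * (S ∪ T)ᶜ.card ≤ u.card := by
  have hne : S ≠ T := by
    rintro rfl
    exact hS.ne_empty (disjoint_self.1 hST)
  have hinj₁ : Set.InjOn (fun a => s(insert a S, T)) ((S ∪ T)ᶜ : Finset α) := by
    intro a ha b hb h
    simp only [Finset.coe_compl, Set.mem_compl_iff, Finset.mem_coe, Finset.mem_union,
      not_or] at ha hb
    rcases Sym2.eq_iff.1 h with ⟨h, -⟩ | ⟨h, -⟩
    · have := h ▸ Finset.mem_insert_self a S
      simpa [ha.1] using this
    · exact absurd (h ▸ Finset.mem_insert_self a S) ha.2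
  have hinj₂ : Set.InjOn (fun a => s(S, insert a T)) ((S ∪ T)ᶜ : Finset α) := by
    intro a ha b hb h
    simp only [Finset.coe_compl, Set.mem_compl_iff, Finset.mem_coe, Finset.mem_union,
      not_or] at ha hb
    rcases Sym2.eq_iff.1 h with ⟨-, h⟩ | ⟨-, h⟩
    · have := h ▸ Finset.mem_insert_self a T
      simpa [ha.2] using this
    · exact absurd (h ▸ Finset.mem_insert_self a T) ha.1
  have hdisj : Disjoint ((S ∪ T)ᶜ.image fun a => s(insert a S, T))
      ((S ∪ T)ᶜ.image fun a => s(S, insert a T)) := by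
    rw [Finset.disjoint_left]
    intro z hz₁ hz₂
    obtain ⟨a, ha, rfl⟩ := Finset.mem_image.1 hz₁
    obtain ⟨b, hb, h⟩ := Finset.mem_image.1 hz₂
    simp only [Finset.mem_compl, Finset.mem_union, not_or] at ha
    rcases Sym2.eq_iff.1 h with ⟨h, -⟩ | ⟨h, -⟩
    · exact ha.1 (h.symm ▸ Finset.mem_insert_self a S)
    · exact hne h
  calc 2 * (S ∪ T)ᶜ.card
      = (((S ∪ T)ᶜ.image fun a => s(insert a S, T)) ∪
          ((S ∪ T)ᶜ.image fun a => s(S, insert a T))).card := by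
        rw [Finset.card_union_of_disjoint hdisj, Finset.card_image_of_injOn hinj₁,
          Finset.card_image_of_injOn hinj₂, two_mul]
    _ ≤ u.card := by
        refine Finset.card_le_card fun z hz => ?_
        simp only [Finset.mem_union, Finset.mem_image, Finset.mem_compl, not_or] at hz
        rcases hz with ⟨a, ha, rfl⟩ | ⟨a, ha, rfl⟩
        · exact (hu a ha.1 ha.2).1
        · exact (hu a ha.1 ha.2).2

theorem stmt9 (n d : ℕ) (hn : 2 ≤ n) (hd1 : d ≤ n - 1) (hd2 : n + 4 ≤ 3 * d)
    (𝒮 : Set (Sym2 (Finset (Fin n))))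
    (h𝒮 : ∀ z ∈ 𝒮, ∃ S T : Finset (Fin n), z = s(S, T) ∧ Disjoint S T ∧
      S.Nonempty ∧ T.Nonempty ∧ S.card + T.card = n - d + 1) :
    𝒮.ncard ≤
      Set.ncard {z' : Sym2 (Finset (Fin n)) |
        (∃ S' T' : Finset (Fin n), z' = s(S', T') ∧ Disjoint S' T' ∧
          S'.Nonempty ∧ T'.Nonempty ∧ S'.card + T'.card = n - d + 2) ∧
        ∃ z ∈ 𝒮, ∃ S T : Finset (Fin n), ∃ a : Fin n,
          z = s(S, T) ∧ a ∉ S ∧ a ∉ T ∧ z' = s(insert a S, T)} := by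
  classical
  rw [Set.ncard_eq_toFinset_card', Set.ncard_eq_toFinset_card']
  refine Nat.le_of_mul_le_mul_right (le_trans (Nat.mul_le_mul_left _ ?_)
    (Finset.card_mul_le_card_mul (m := 2 * (d - 1)) (n := n - d + 2) Adjoins
      (fun z hz => ?_) fun z' hz' => ?_)) (show 0 < n - d + 2 by omega)
  · omega
  · rw [Set.mem_toFinset] at hz
    obtain ⟨S, T, rfl, hST, hS, hT, hcard⟩ := h𝒮 z hz
    have hcompl : (S ∪ T)ᶜ.card = d - 1 := by
      rw [Finset.card_compl, Finset.card_union_of_disjoint hST, hcard, Fintype.card_fin]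
      omega
    rw [← hcompl]
    refine two_mul_card_compl_le_card_of_adjoins hST hS _ fun a haS haT => ?_
    rw [Finset.mem_bipartiteAbove, Finset.mem_bipartiteAbove, Set.mem_toFinset,
      Set.mem_toFinset]
    have h₁ : Adjoins s(S, T) s(insert a S, T) := ⟨S, T, a, rfl, haS, haT, rfl⟩
    have h₂ : Adjoins s(S, T) s(S, insert a T) :=
      ⟨T, S, a, Sym2.eq_swap, haT, haS, Sym2.eq_swap⟩
    refine ⟨⟨⟨⟨insert a S, T, rfl, ?_, Finset.insert_nonempty _ _, hT, ?_⟩, _, hz, h₁⟩, h₁⟩,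
      ⟨⟨S, insert a T, rfl, ?_, hS, Finset.insert_nonempty _ _, ?_⟩, _, hz, h₂⟩, h₂⟩
    · exact Finset.disjoint_insert_left.2 ⟨haT, hST⟩
    · rw [Finset.card_insert_of_notMem haS]
      omega
    · exact Finset.disjoint_insert_right.2 ⟨haS, hST⟩
    · rw [Finset.card_insert_of_notMem haT]
      omega
  · rw [Set.mem_toFinset] at hz'
    obtain ⟨⟨S', T', rfl, hST, -, -, hcard⟩, -⟩ := hz'
    rw [← hcard, ← Finset.card_union_of_disjoint hST]
    exact (Finset.card_le_card fun z hz =>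
      ((Finset.mem_bipartiteBelow _).1 hz).2.mem_image_erase hST).trans Finset.card_image_le
end

section
/- For every n ≥ 2 and every d with 1 ≤ d ≤ n − 1, the inequality C(n, d−1)·(2^{n−d} − 1) ≤ C(n, ⌊n/3⌋)·(2^{n − ⌊n/3⌋ − 1} − 1) holds; i.e., among the rank levels of the lattice of double-faces, the level of dimension d* = ⌊n/3⌋ + 1 is the largest. -/
/-- Below level `n / 3`, the number of double-faces increases with the level. -/
theorem choose_mul_two_pow_sub_one_le_succ {n k : ℕ} (h : 3 * (k + 1) ≤ n) :
    n.choose k * (2 ^ (n - k - 1) - 1) ≤ n.choose (k + 1) * (2 ^ (n - (k + 1) - 1) - 1) := by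
  obtain ⟨m, rfl⟩ : ∃ m, n = k + 2 + m := ⟨n - (k + 2), by omega⟩
  have hC := Nat.choose_succ_right_eq (k + 2 + m) k
  rw [show k + 2 + m - k = m + 2 by omega] at hC
  rw [show k + 2 + m - k - 1 = m + 1 by omega, show k + 2 + m - (k + 1) - 1 = m by omega]
  have hm : m < 2 ^ m := Nat.lt_two_pow_self
  obtain ⟨a, ha⟩ : ∃ a, 2 ^ m = a + 1 := ⟨2 ^ m - 1, by omega⟩
  have hB : 2 ^ (m + 1) - 1 = 2 * a + 1 := by omega
  rw [hB, ha, Nat.add_sub_cancel]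
  refine Nat.le_of_mul_le_mul_right ?_ k.succ_pos
  calc (k + 2 + m).choose k * (2 * a + 1) * (k + 1)
      = (k + 2 + m).choose k * ((2 * a + 1) * (k + 1)) := by ring
    _ ≤ (k + 2 + m).choose k * ((m + 2) * a) := by
        refine Nat.mul_le_mul_left _ ?_
        have h1 : 2 * k + 3 ≤ m + 2 := by omega
        have h2 : k + 1 ≤ a := by omega
        nlinarith [Nat.mul_le_mul_right a h1]
    _ = (k + 2 + m).choose (k + 1) * (k + 1) * a := by rw [hC]; ring
    _ = (k + 2 + m).choose (k + 1) * a * (k + 1) := by ring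

/-- From level `n / 3` on, the number of double-faces decreases with the level. -/
theorem choose_succ_mul_two_pow_sub_one_le {n k : ℕ} (h : n / 3 ≤ k) (hk : k + 2 ≤ n) :
    n.choose (k + 1) * (2 ^ (n - (k + 1) - 1) - 1) ≤ n.choose k * (2 ^ (n - k - 1) - 1) := by
  obtain ⟨m, rfl⟩ : ∃ m, n = k + 2 + m := ⟨n - (k + 2), by omega⟩
  have hC := Nat.choose_succ_right_eq (k + 2 + m) k
  rw [show k + 2 + m - k = m + 2 by omega] at hC
  rw [show k + 2 + m - k - 1 = m + 1 by omega, show k + 2 + m - (k + 1) - 1 = m by omega]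
  have hm : m < 2 ^ m := Nat.lt_two_pow_self
  obtain ⟨a, ha⟩ : ∃ a, 2 ^ m = a + 1 := ⟨2 ^ m - 1, by omega⟩
  have hB : 2 ^ (m + 1) - 1 = 2 * a + 1 := by omega
  rw [hB, ha, Nat.add_sub_cancel]
  refine Nat.le_of_mul_le_mul_right ?_ k.succ_pos
  calc (k + 2 + m).choose (k + 1) * a * (k + 1)
      = (k + 2 + m).choose (k + 1) * (k + 1) * a := by ring
    _ = (k + 2 + m).choose k * ((m + 2) * a) := by rw [hC]; ring
    _ ≤ (k + 2 + m).choose k * ((2 * a + 1) * (k + 1)) := by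
        refine Nat.mul_le_mul_left _ ?_
        have h1 : m + 2 ≤ 2 * (k + 1) := by omega
        nlinarith [Nat.mul_le_mul_right a h1]
    _ = (k + 2 + m).choose k * (2 * a + 1) * (k + 1) := by ring

theorem stmt12 (n d : ℕ) (hn : 2 ≤ n) (hd1 : 1 ≤ d) (hd2 : d ≤ n - 1) :
    n.choose (d - 1) * (2 ^ (n - d) - 1) ≤
      n.choose (n / 3) * (2 ^ (n - n / 3 - 1) - 1) := by
  obtain ⟨k, rfl⟩ : ∃ k, d = k + 1 := ⟨d - 1, by omega⟩
  rw [Nat.add_sub_cancel, ← Nat.sub_sub]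
  rcases le_total k (n / 3) with h | h
  · have up : ∀ j, k ≤ j → j ≤ n / 3 →
        n.choose k * (2 ^ (n - k - 1) - 1) ≤ n.choose j * (2 ^ (n - j - 1) - 1) := by
      intro j hj
      induction j, hj using Nat.le_induction with
      | base => exact fun _ => le_rfl
      | succ j _ ih =>
        exact fun hj => (ih (by omega)).trans (choose_mul_two_pow_sub_one_le_succ (by omega))
    exact up _ h le_rfl
  · have hk : k + 2 ≤ n := by omega
    clear hd1 hd2
    induction k, h using Nat.le_induction with
    | base => exact le_rfl
    | succ j hj ih =>
      exact (choose_succ_mul_two_pow_sub_one_le hj (by omega)).trans (ih (by omega))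
end

section
/- Let ν be a seminorm on ℝ^n, let Σ be a finite set of n×n real matrices with ν(Ax) ≤ ν(x) for every A ∈ Σ and x ∈ ℝ^n, and suppose there exists p ≥ 1 such that every product M = A_p ⋯ A_1 of p matrices from Σ satisfies ν(Mx) < 1 whenever ν(x) ≤ 1. Then there exist C > 0 and r ∈ [0,1) such that for every sequence σ : ℕ → Σ, every t ≥ 0 and every x ∈ ℝ^n, ν(A_{σ(t)} ⋯ A_{σ(1)} x) ≤ C·r^t·ν(x); in particular every trajectory of the switching system x(t+1) = A_{σ(t)} x(t) approaches the set {x : ν(x) = 0} exponentially fast. -/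
open Matrix

/-- Partial products `P t = σ(t) ⋯ σ(1)` of a sequence of matrices (P 0 = identity). -/
def partialProd {n : ℕ} (σ : ℕ → Matrix (Fin n) (Fin n) ℝ) : ℕ → Matrix (Fin n) (Fin n) ℝ
  | 0 => 1
  | t + 1 => σ (t + 1) * partialProd σ t

theorem Seminorm.continuous_of_finiteDimensional {E : Type*} [NormedAddCommGroup E]
    [NormedSpace ℝ E] [FiniteDimensional ℝ E] (q : Seminorm ℝ E) : Continuous q :=
  continuousOn_univ.mp (q.convexOn.continuousOn isOpen_univ)

/-- In finite dimensions, a seminorm that is `< 1` on the closed unit ball of another seminorm is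
bounded by a strict multiple of it. The unit ball need not be compact. -/
theorem Seminorm.exists_lt_one_forall_le_mul {E : Type*} [NormedAddCommGroup E]
    [NormedSpace ℝ E] [FiniteDimensional ℝ E] (ν q : Seminorm ℝ E)
    (h : ∀ x, ν x ≤ 1 → q x < 1) : ∃ r < 1, ∀ x, q x ≤ r * ν x := by
  have hlt : ∀ x, 0 < ν x → q x < ν x := by
    intro x hx
    have h1 := h ((ν x)⁻¹ • x) (by
      rw [map_smul_eq_mul, Real.norm_of_nonneg (by positivity), inv_mul_cancel₀ hx.ne'])
    rw [map_smul_eq_mul, Real.norm_of_nonneg (by positivity), inv_mul_eq_div,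
      div_lt_one hx] at h1
    exact h1
  have hker : ∀ x, ν x = 0 → q x = 0 := by
    intro x hx
    by_contra hne
    have h1 := h ((q x)⁻¹ • x) (by rw [map_smul_eq_mul, hx]; norm_num)
    rw [map_smul_eq_mul, Real.norm_of_nonneg (inv_nonneg.mpr (apply_nonneg q x)),
      inv_mul_cancel₀ hne] at h1
    exact lt_irrefl _ h1
  let K : Submodule ℝ E :=
    { carrier := {x | ν x = 0}
      zero_mem' := map_zero ν
      add_mem' := fun {a b} ha hb => le_antisymm
        ((map_add_le_add ν a b).trans_eq (by rw [ha, hb, add_zero])) (apply_nonneg ν _)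
      smul_mem' := fun c x hx => by
        change ν (c • x) = 0
        rw [map_smul_eq_mul, show ν x = 0 from hx, mul_zero] }
  obtain ⟨W, hW⟩ := K.exists_isCompl
  have hpos : ∀ x ∈ W, x ≠ 0 → 0 < ν x := fun x hx hx0 =>
    (apply_nonneg ν x).lt_of_ne fun h0 =>
      hx0 (Submodule.disjoint_def.mp hW.disjoint x h0.symm hx)
  have hcompact : IsCompact (Metric.sphere (0 : E) 1 ∩ W) :=
    (isCompact_sphere 0 1).inter_right W.closed_of_finiteDimensional
  have hS : ∀ x ∈ Metric.sphere (0 : E) 1 ∩ W, 0 < ν x := fun x hx =>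
    hpos x hx.2 (norm_ne_zero_iff.mp (by rw [mem_sphere_zero_iff_norm.mp hx.1]; norm_num))
  have hbound : ∃ r < 1, ∀ x ∈ Metric.sphere (0 : E) 1 ∩ W, q x ≤ r * ν x := by
    rcases (Metric.sphere (0 : E) 1 ∩ W).eq_empty_or_nonempty with he | hne
    · exact ⟨0, one_pos, fun x hx => by simp [he] at hx⟩
    · obtain ⟨z, hz, hmax⟩ := hcompact.exists_isMaxOn hne
        (q.continuous_of_finiteDimensional.continuousOn.div
          ν.continuous_of_finiteDimensional.continuousOn fun x hx => (hS x hx).ne')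
      exact ⟨q z / ν z, (div_lt_one (hS z hz)).mpr (hlt z (hS z hz)), fun x hx =>
        (div_le_iff₀ (hS x hx)).mp (hmax hx)⟩
  obtain ⟨r, hr, hrS⟩ := hbound
  have hrW : ∀ w ∈ W, q w ≤ r * ν w := by
    intro w hw
    by_cases hw0 : w = 0
    · simp [hw0]
    have hn : 0 < ‖w‖ := norm_pos_iff.mpr hw0
    have h1 := hrS (‖w‖⁻¹ • w)
      ⟨mem_sphere_zero_iff_norm.mpr (norm_smul_inv_norm (𝕜 := ℝ) hw0), W.smul_mem _ hw⟩
    rw [map_smul_eq_mul, map_smul_eq_mul, mul_left_comm] at h1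
    exact le_of_mul_le_mul_left h1 (by simpa using hn)
  refine ⟨r, hr, fun x => ?_⟩
  obtain ⟨k, hk, w, hw, rfl⟩ := Submodule.mem_sup.mp
    (hW.sup_eq_top ▸ Submodule.mem_top : x ∈ K ⊔ W)
  have hk0 : ν k = 0 := hk
  have hν : ν (k + w) = ν w := by
    refine le_antisymm ((map_add_le_add ν k w).trans_eq (by rw [hk0, zero_add])) ?_
    have h1 := map_sub_le_add ν (k + w) k
    rwa [add_sub_cancel_left, hk0, add_zero] at h1
  rw [hν]
  exact (map_add_le_add q k w).trans (by rw [hker k hk0, zero_add]; exact hrW w hw)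

theorem partialProd_add {n : ℕ} (σ : ℕ → Matrix (Fin n) (Fin n) ℝ) (t p : ℕ) :
    partialProd σ (t + p) =
      (List.ofFn fun i : Fin p => σ (t + p - i)).prod * partialProd σ t := by
  induction p with
  | zero => simp
  | succ p ih =>
    rw [List.ofFn_succ, List.prod_cons, mul_assoc, ← add_assoc, partialProd, ih]
    simp only [Fin.val_zero, Fin.val_succ, Nat.sub_zero, Nat.add_sub_add_right]

/-- A nonnegative sequence bounded by its initial value and contracted by the factor `r ^ p` every
`p` steps decays geometrically. -/
theorem le_geometric_of_contract_every {f : ℕ → ℝ} {p : ℕ} (hp : 1 ≤ p) {r : ℝ} (hr0 : 0 < r)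
    (hr1 : r ≤ 1) (hf0 : 0 ≤ f 0) (hf : ∀ t, f t ≤ f 0)
    (hcontr : ∀ t, f (t + p) ≤ r ^ p * f t) (t : ℕ) :
    f t ≤ (r ^ p)⁻¹ * r ^ t * f 0 := by
  induction t using Nat.strong_induction_on with
  | _ t ih =>
    rcases lt_or_ge t p with htp | htp
    · refine (hf t).trans (le_mul_of_one_le_left hf0 ?_)
      rw [inv_mul_eq_div, one_le_div (by positivity)]
      exact pow_le_pow_of_le_one hr0.le hr1 htp.le
    · obtain ⟨s, rfl⟩ := Nat.exists_eq_add_of_le' htp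
      calc f (s + p) ≤ r ^ p * f s := hcontr s
        _ ≤ r ^ p * ((r ^ p)⁻¹ * r ^ s * f 0) := by gcongr; exact ih s (by omega)
        _ = (r ^ p)⁻¹ * r ^ (s + p) * f 0 := by ring

theorem stmt15 (n : ℕ) (ν : (Fin n → ℝ) → ℝ)
    (hhom : ∀ (a : ℝ) (x : Fin n → ℝ), ν (a • x) = |a| * ν x)
    (htri : ∀ x y : Fin n → ℝ, ν (x + y) ≤ ν x + ν y)
    (Sig : Finset (Matrix (Fin n) (Fin n) ℝ))
    (hmono : ∀ A ∈ Sig, ∀ x : Fin n → ℝ, ν (A.mulVec x) ≤ ν x)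
    (p : ℕ) (hp : 1 ≤ p)
    (hcontr : ∀ B : Fin p → Matrix (Fin n) (Fin n) ℝ, (∀ i, B i ∈ Sig) →
      ∀ x : Fin n → ℝ, ν x ≤ 1 → ν ((List.ofFn B).prod.mulVec x) < 1) :
    ∃ C : ℝ, 0 < C ∧ ∃ r : ℝ, 0 ≤ r ∧ r < 1 ∧
      ∀ σ : ℕ → Matrix (Fin n) (Fin n) ℝ, (∀ t, σ t ∈ Sig) →
        ∀ (t : ℕ) (x : Fin n → ℝ),
          ν ((partialProd σ t).mulVec x) ≤ C * r ^ t * ν x := by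
  let N : Seminorm ℝ (Fin n → ℝ) := Seminorm.of ν htri hhom
  have hnonneg : ∀ x, 0 ≤ ν x := fun x => apply_nonneg N x
  let q : Seminorm ℝ (Fin n → ℝ) := (Finset.univ : Finset (Fin p → Sig)).sup fun B =>
    N.comp (List.ofFn fun i => (B i : Matrix (Fin n) (Fin n) ℝ)).prod.mulVecLin
  obtain ⟨ρ, hρ, hle⟩ := N.exists_lt_one_forall_le_mul q fun x hx =>
    Seminorm.finset_sup_apply_lt one_pos fun B _ => hcontr _ (fun i => (B i).2) x hx
  have hp0 : p ≠ 0 := Nat.one_le_iff_ne_zero.mp hp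
  have hm0 : 0 < max ρ (1 / 2) := lt_max_of_lt_right (by norm_num)
  have hm1 : max ρ (1 / 2) < 1 := max_lt hρ (by norm_num)
  obtain ⟨r, hr0, hrp⟩ : ∃ r : ℝ, 0 < r ∧ r ^ p = max ρ (1 / 2) :=
    ⟨max ρ (1 / 2) ^ (p : ℝ)⁻¹, Real.rpow_pos_of_pos hm0 _,
      Real.rpow_inv_natCast_pow hm0.le hp0⟩
  have hr1 : r < 1 := (pow_lt_one_iff_of_nonneg hr0.le hp0).mp (hrp ▸ hm1)
  refine ⟨(r ^ p)⁻¹, by positivity, r, hr0.le, hr1, fun σ hσ t x => ?_⟩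
  have hzero : (partialProd σ 0).mulVec x = x := one_mulVec x
  have hdecay := le_geometric_of_contract_every (f := fun t => ν ((partialProd σ t).mulVec x))
    hp hr0 hr1.le (hnonneg _) ?_ ?_ t
  · simpa only [hzero] using hdecay
  · intro s
    induction s with
    | zero => exact le_rfl
    | succ s ih =>
      refine le_trans ?_ ih
      change ν ((σ (s + 1) * partialProd σ s).mulVec x) ≤ _
      rw [← mulVec_mulVec]
      exact hmono _ (hσ _) _
  · intro s
    simp only [partialProd_add σ s p, ← mulVec_mulVec]
    let B : Fin p → Sig := fun i => ⟨σ (s + p - i), hσ _⟩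
    have hB : N.comp (List.ofFn fun i => (B i : Matrix (Fin n) (Fin n) ℝ)).prod.mulVecLin ≤ q :=
      Finset.le_sup (f := fun B : Fin p → Sig =>
        N.comp (List.ofFn fun i => (B i : Matrix (Fin n) (Fin n) ℝ)).prod.mulVecLin)
        (Finset.mem_univ B)
    refine ((hB _).trans (hle _)).trans ?_
    rw [hrp]
    exact mul_le_mul_of_nonneg_right (le_max_left _ _) (hnonneg _)
end

section
/- Let n ≥ 2 and let S, T be disjoint nonempty subsets of {1,…,n}. Let P = {x ∈ ℝ^n : max_i x_i − min_i x_i ≤ 2} and F_{S,T} = {x ∈ P : x_j − x_i = 2 for all i ∈ S and all j ∈ T}. Then F_{S,T} is a nonempty exposed face of the convex set P, and the direction of its affine span has dimension n − |S| − |T| + 1. -/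
open Matrix

lemma iSup_sub_iInf_le_iff {ι : Type*} [Finite ι] [Nonempty ι] (x : ι → ℝ) (c : ℝ) :
    (⨆ i, x i) - ⨅ i, x i ≤ c ↔ ∀ i j, x j - x i ≤ c := by
  constructor
  · intro h i j
    have h₁ := le_ciSup (Set.finite_range x).bddAbove j
    have h₂ := ciInf_le (Set.finite_range x).bddBelow i
    linarith
  · intro h
    obtain ⟨j, hj⟩ := exists_eq_ciSup_of_finite (f := x)
    obtain ⟨i, hi⟩ := exists_eq_ciInf_of_finite (f := x)
    rw [← hi, ← hj]
    exact h i j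

/-- The map identifying all points of `U` to the single point `none`. -/
def collapse {ι : Type*} [DecidableEq ι] (U : Finset ι) (k : ι) : Option {k // k ∉ U} :=
  if h : k ∈ U then none else some ⟨k, h⟩

lemma collapse_surjective {ι : Type*} [DecidableEq ι] {U : Finset ι} (hU : U.Nonempty) :
    Function.Surjective (collapse U) := by
  rintro (_ | ⟨k, hk⟩)
  · obtain ⟨k, hk⟩ := hU
    exact ⟨k, by simp [collapse, hk]⟩
  · exact ⟨k, by simp [collapse, hk]⟩

/-- The subspace of functions that are constant on `U`. -/
def constOn {ι : Type*} [DecidableEq ι] (U : Finset ι) : Submodule ℝ (ι → ℝ) :=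
  LinearMap.range (LinearMap.funLeft ℝ ℝ (collapse U))

lemma mem_constOn {ι : Type*} [DecidableEq ι] {U : Finset ι} {v : ι → ℝ} :
    v ∈ constOn U ↔ ∃ c, ∀ k ∈ U, v k = c := by
  constructor
  · rintro ⟨f, rfl⟩
    exact ⟨f none, fun k hk => by simp [LinearMap.funLeft_apply, collapse, hk]⟩
  · rintro ⟨c, hc⟩
    refine ⟨fun o => o.elim c fun k => v k, ?_⟩
    ext k
    by_cases hk : k ∈ U
    · simp [LinearMap.funLeft_apply, collapse, hk, hc k hk]
    · simp [LinearMap.funLeft_apply, collapse, hk]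

lemma finrank_constOn {ι : Type*} [Fintype ι] [DecidableEq ι] {U : Finset ι}
    (hU : U.Nonempty) :
    Module.finrank ℝ (constOn U) = Fintype.card ι - U.card + 1 := by
  rw [constOn, LinearMap.finrank_range_of_inj
    (LinearMap.funLeft_injective_of_surjective ℝ ℝ _ (collapse_surjective hU))]
  simp [Fintype.card_subtype_compl]

/-- The vector with value `-1` on `S`, `1` on `T` and `0` elsewhere. -/
def signVector {ι : Type*} [DecidableEq ι] (S T : Finset ι) (k : ι) : ℝ :=
  if k ∈ S then -1 else if k ∈ T then 1 else 0

/-- The points of the ball `{x | ∀ i j, x j - x i ≤ 2}` with `x j - x i = 2` for all `i ∈ S` and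
`j ∈ T`. -/
def tropicalFace {ι : Type*} (S T : Finset ι) : Set (ι → ℝ) :=
  {x | (∀ i j, x j - x i ≤ 2) ∧ ∀ i ∈ S, ∀ j ∈ T, x j - x i = 2}

section

variable {ι : Type*} [DecidableEq ι] {S T : Finset ι}

lemma signVector_add_mem_tropicalFace (hST : Disjoint S T) {v : ι → ℝ} {c : ℝ}
    (hv : ∀ k ∈ S ∪ T, v k = c) (hc : ∀ k, |v k - c| ≤ 1) :
    signVector S T + v ∈ tropicalFace S T := by
  have bounds : ∀ k, -1 ≤ signVector S T k + v k - c ∧ signVector S T k + v k - c ≤ 1 := by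
    intro k
    have hk := abs_le.1 (hc k)
    have hvk := hv k
    simp only [Finset.mem_union] at hvk
    unfold signVector
    split_ifs with h₁ h₂
    · rw [hvk (.inl h₁)]; norm_num
    · rw [hvk (.inr h₂)]; norm_num
    · constructor <;> linarith
  refine ⟨fun i j => ?_, fun i hi j hj => ?_⟩
  · have h₁ := (bounds i).1
    have h₂ := (bounds j).2
    simp only [Pi.add_apply]
    linarith
  · have hjS := Finset.disjoint_right.1 hST hj
    simp only [Pi.add_apply, signVector, hi, hj, hjS, if_true, if_false,
      hv i (Finset.mem_union_left _ hi), hv j (Finset.mem_union_right _ hj)]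
    ring

lemma signVector_mem_tropicalFace (hST : Disjoint S T) :
    signVector S T ∈ tropicalFace S T := by
  simpa using signVector_add_mem_tropicalFace hST (v := 0) (c := 0) (by simp) (by simp)

variable [Fintype ι]

lemma vectorSpan_tropicalFace (hST : Disjoint S T) (hS : S.Nonempty) (hT : T.Nonempty) :
    vectorSpan ℝ (tropicalFace S T) = constOn (S ∪ T) := by
  apply le_antisymm
  · refine Submodule.span_le.2 ?_
    rintro _ ⟨x, hx, y, hy, rfl⟩
    obtain ⟨i, hi⟩ := hS
    obtain ⟨j, hj⟩ := hT
    refine mem_constOn.2 ⟨x i - y i, fun k hk => ?_⟩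
    simp only [vsub_eq_sub, Pi.sub_apply]
    have hx₁ := hx.2 i hi j hj
    have hy₁ := hy.2 i hi j hj
    rcases Finset.mem_union.1 hk with hk | hk
    · linarith [hx.2 k hk j hj, hy.2 k hk j hj]
    · linarith [hx.2 i hi k hk, hy.2 i hi k hk]
  · intro v hv
    obtain ⟨c, hc⟩ := mem_constOn.1 hv
    have hpos : 0 < 2 * ‖v‖ + 1 := by positivity
    have hcv : |c| ≤ ‖v‖ := by
      obtain ⟨i, hi⟩ := hS
      rw [← hc i (Finset.mem_union_left _ hi)]
      exact norm_le_pi_norm v i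
    have hmem : signVector S T + (2 * ‖v‖ + 1)⁻¹ • v ∈ tropicalFace S T := by
      refine signVector_add_mem_tropicalFace hST (c := (2 * ‖v‖ + 1)⁻¹ * c)
        (fun k hk => by simp [hc k hk]) fun k => ?_
      have hvk : |v k| ≤ ‖v‖ := norm_le_pi_norm v k
      rw [Pi.smul_apply, smul_eq_mul, ← mul_sub, abs_mul, abs_of_pos (inv_pos.2 hpos),
        inv_mul_le_iff₀ hpos]
      linarith [abs_sub (v k) c]
    have hsub := vsub_mem_vectorSpan ℝ hmem (signVector_mem_tropicalFace hST)
    rw [vsub_eq_sub, add_sub_cancel_left] at hsub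
    exact (Submodule.smul_mem_iff _ (inv_ne_zero hpos.ne')).1 hsub

lemma exists_exposing_functional (S T : Finset ι) :
    ∃ (b : ι → ℝ) (c : ℝ), ∀ x : ι → ℝ, (∀ i j, x j - x i ≤ 2) →
      b ⬝ᵥ x ≤ c ∧ (b ⬝ᵥ x = c ↔ ∀ i ∈ S, ∀ j ∈ T, x j - x i = 2) := by
  refine ⟨∑ p ∈ S ×ˢ T, (Pi.single p.2 1 - Pi.single p.1 1), ∑ p ∈ S ×ˢ T, 2, fun x hx => ?_⟩
  have hle : ∀ p ∈ S ×ˢ T, x p.2 - x p.1 ≤ 2 := fun p _ => hx p.1 p.2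
  simp only [sum_dotProduct, sub_dotProduct, single_one_dotProduct]
  refine ⟨Finset.sum_le_sum hle, ?_⟩
  rw [Finset.sum_eq_sum_iff_of_le hle]
  simp only [Finset.mem_product, Prod.forall]
  exact ⟨fun h i hi j hj => h i j ⟨hi, hj⟩, fun h i j hij => h i hij.1 j hij.2⟩

end

theorem stmt17 (n : ℕ) (hn : 2 ≤ n) (S T : Finset (Fin n)) (hST : Disjoint S T)
    (hS : S.Nonempty) (hT : T.Nonempty)
    (P : Set (Fin n → ℝ)) (hP : P = {x | (⨆ i, x i) - ⨅ i, x i ≤ 2})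
    (F : Set (Fin n → ℝ))
    (hF : F = {x ∈ P | ∀ i ∈ S, ∀ j ∈ T, x j - x i = 2}) :
    F.Nonempty ∧
    (F = P ∨ ∃ (b : Fin n → ℝ) (c : ℝ),
      (∀ x ∈ P, b ⬝ᵥ x ≤ c) ∧ F = P ∩ {x | b ⬝ᵥ x = c}) ∧
    Module.finrank ℝ (affineSpan ℝ F).direction = n - S.card - T.card + 1 := by
  have : Nonempty (Fin n) := ⟨hS.choose⟩
  have hmemP : ∀ x, x ∈ P ↔ ∀ i j, x j - x i ≤ 2 := fun x => by
    rw [hP]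
    exact iSup_sub_iInf_le_iff x 2
  have hFace : F = tropicalFace S T := by
    ext x
    rw [hF, Set.mem_ofPred_eq, hmemP]
    rfl
  refine ⟨hFace ▸ ⟨_, signVector_mem_tropicalFace hST⟩, .inr ?_, ?_⟩
  · obtain ⟨b, c, hbc⟩ := exists_exposing_functional S T
    refine ⟨b, c, fun x hx => (hbc x ((hmemP x).1 hx)).1, ?_⟩
    ext x
    rw [hF]
    exact and_congr_right fun hx => (hbc x ((hmemP x).1 hx)).2.symm
  · rw [direction_affineSpan, hFace, vectorSpan_tropicalFace hST hS hT,
      finrank_constOn (hS.mono Finset.subset_union_left), Finset.card_union_of_disjoint hST,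
      Fintype.card_fin, Nat.sub_sub]
end
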